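/- Let A be a real n×n matrix and let P = {(x, Ax) : x ∈ ℝ^n} ⊆ ℝ^n × ℝ^n be its graph. Then the following are equivalent: (a) the symplectic form ω vanishes identically on P, the split inner product is positive definite on P, and the n-form Im dz vanishes on every n-tuple of vectors from P; (b) A is symmetric, AᵀA < I in the Loewner order (equivalently −I < A < I), and det(I + A) = det(I − A). -/

import Mathlib

open Matrix

/-- The alternating `n`-form `Im dz` on `D^n = ℝ^n × ℝ^n`:
`(Im dz)(w₁,…,w_n) = ½[det(x₁+y₁ | … | x_n+y_n) − det(x₁−y₁ | … | x_n−y_n)]`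
for `w_i = (x_i, y_i)`. -/
noncomputable def imDz {n : ℕ} (w : Fin n → (Fin n → ℝ) × (Fin n → ℝ)) : ℝ :=
  (1 / 2) * ((Matrix.of fun i j : Fin n => (w j).1 i + (w j).2 i).det -
    (Matrix.of fun i j : Fin n => (w j).1 i - (w j).2 i).det)

theorem imDz_graph {n : ℕ} (A : Matrix (Fin n) (Fin n) ℝ) (w : Fin n → Fin n → ℝ) :
    imDz (fun i => (w i, A *ᵥ w i)) =
      (1 / 2) * (((1 + A).det - (1 - A).det) * (Matrix.of w).det) := by
  have hadd : (Matrix.of fun i j : Fin n => w j i + (A *ᵥ w j) i) =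
      (1 + A) * (Matrix.of w)ᵀ := by
    rw [add_mul, one_mul]
    rfl
  have hsub : (Matrix.of fun i j : Fin n => w j i - (A *ᵥ w j) i) =
      (1 - A) * (Matrix.of w)ᵀ := by
    rw [sub_mul, one_mul]
    rfl
  rw [imDz, hadd, hsub, det_mul, det_mul, det_transpose, sub_mul]

theorem forall_imDz_graph_eq_zero_iff {n : ℕ} (A : Matrix (Fin n) (Fin n) ℝ) :
    (∀ w : Fin n → Fin n → ℝ, imDz (fun i => (w i, A *ᵥ w i)) = 0) ↔
      (1 + A).det = (1 - A).det := by
  simp only [imDz_graph]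
  refine ⟨fun h => ?_, fun h w => by simp [h]⟩
  have h1 := h (1 : Matrix (Fin n) (Fin n) ℝ)
  rw [show Matrix.of (1 : Matrix (Fin n) (Fin n) ℝ) = 1 from rfl, det_one] at h1
  linarith

theorem forall_dotProduct_mulVec_sub_eq_zero_iff_isSymm {ι R : Type*} [Fintype ι] [CommRing R]
    (A : Matrix ι ι R) :
    (∀ x y : ι → R, x ⬝ᵥ A *ᵥ y - A *ᵥ x ⬝ᵥ y = 0) ↔ A.IsSymm := by
  classical
  refine ⟨fun h => ?_, fun h x y => ?_⟩
  · ext i j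
    simpa [sub_eq_zero] using (h (Pi.single j 1) (Pi.single i 1))
  · rw [dotProduct_mulVec, ← mulVec_transpose, h.eq, sub_self]

theorem posDef_one_sub_transpose_mul_self_iff {ι : Type*} [Fintype ι] [DecidableEq ι]
    (A : Matrix ι ι ℝ) :
    (1 - Aᵀ * A).PosDef ↔ ∀ x : ι → ℝ, x ≠ 0 → 0 < x ⬝ᵥ x - A *ᵥ x ⬝ᵥ A *ᵥ x := by
  have hH : (1 - Aᵀ * A).IsHermitian := by
    simp [IsHermitian, conjTranspose_eq_transpose_of_trivial]
  have hq (x : ι → ℝ) : star x ⬝ᵥ (1 - Aᵀ * A) *ᵥ x = x ⬝ᵥ x - A *ᵥ x ⬝ᵥ A *ᵥ x := by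
    rw [star_trivial, sub_mulVec, one_mulVec, dotProduct_sub, ← mulVec_mulVec,
      dotProduct_mulVec, vecMul_transpose]
  simp only [posDef_iff_dotProduct_mulVec, hH, hq, true_and]

/-- **Proposition 6.2** of Harvey–Lawson, "Split Special Lagrangian Geometry":
the graph `P = {(x, Ax)}` in `D^n = ℝ^n × ℝ^n` is split special Lagrangian — i.e. the
symplectic form `ω((x,y),(x',y')) = x⋅y' − y⋅x'` vanishes on `P`, the split inner product
`⟨(x,y),(x',y')⟩ = x⋅x' − y⋅y'` is positive definite on `P`, and `Im dz` vanishes on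
n-tuples of vectors from `P` — if and only if `A` is symmetric with `AᵀA < I` and
`det(I + A) = det(I − A)`. -/
theorem splitSLAG_graph_characterization (n : ℕ) (A : Matrix (Fin n) (Fin n) ℝ) :
    ((∀ x y : Fin n → ℝ, x ⬝ᵥ A.mulVec y - A.mulVec x ⬝ᵥ y = 0) ∧
      (∀ x : Fin n → ℝ, x ≠ 0 → 0 < x ⬝ᵥ x - A.mulVec x ⬝ᵥ A.mulVec x) ∧
      (∀ w : Fin n → Fin n → ℝ, imDz (fun i => (w i, A.mulVec (w i))) = 0)) ↔
    (A.IsSymm ∧ (1 - Aᵀ * A).PosDef ∧ (1 + A).det = (1 - A).det) := by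
  rw [forall_dotProduct_mulVec_sub_eq_zero_iff_isSymm, forall_imDz_graph_eq_zero_iff,
    posDef_one_sub_transpose_mul_self_iff]
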